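/- For the multi-access combinatorial coded caching system with C caches, access degree r, K = C(C,r) users and N ≥ 2 files, every achievable secretive-and-private memory–rate pair (M,R) satisfies R ≥ 1; that is, R*(M) ≥ 1 for every M. -/

import Mathlib

open Finset

/-- Probability that the finitely-valued random variable `X` takes the value `a`,
on the finite probability space with mass function `μ`. -/
noncomputable def probOf {Ω α : Type} [Fintype Ω] [DecidableEq α]
    (μ : Ω → ℝ) (X : Ω → α) (a : α) : ℝ :=
  ∑ ω ∈ Finset.univ.filter (fun ω => X ω = a), μ ω

/-- Shannon entropy (in bits) of a finitely-valued random variable. -/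
noncomputable def shannonH {Ω α : Type} [Fintype Ω] [Fintype α] [DecidableEq α]
    (μ : Ω → ℝ) (X : Ω → α) : ℝ :=
  (∑ a : α, Real.negMulLog (probOf μ X a)) / Real.log 2

/-- Conditional Shannon entropy `H(X | Y)` (in bits). -/
noncomputable def condH {Ω α β : Type} [Fintype Ω] [Fintype α] [Fintype β]
    [DecidableEq α] [DecidableEq β] (μ : Ω → ℝ) (X : Ω → α) (Y : Ω → β) : ℝ :=
  shannonH μ (fun ω => (X ω, Y ω)) - shannonH μ Y

/-- Mutual information `I(X ; Y)` (in bits). -/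
noncomputable def mutInf {Ω α β : Type} [Fintype Ω] [Fintype α] [Fintype β]
    [DecidableEq α] [DecidableEq β] (μ : Ω → ℝ) (X : Ω → α) (Y : Ω → β) : ℝ :=
  shannonH μ X + shannonH μ Y - shannonH μ (fun ω => (X ω, Y ω))
/-- The users of the multi-access combinatorial topology with `C` caches and access
degree `r`: each user is indexed by an `r`-subset of `[C]`. -/
abbrev UserT (C r : ℕ) := {G : Finset (Fin C) // G.card = r}

/-- A secretive and demand-private coded caching scheme for the multi-access
combinatorial topology with `C` caches, access degree `r`, `N` files of `F` bits
each, cache size `M` files and rate `R`.  The server randomness `P`, the files `W`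
(i.i.d. uniform bits) and the demands `D` (uniform on `[N]^K`) are mutually
independent; the cache contents `ψ c (P, W)` take at most `2^(M·F)` values and the
transmission `φ (P, D, W)` takes at most `2^(R·F)` values; the scheme satisfies the
correctness, secrecy and demand-privacy conditions. -/
structure CCScheme (C r N F : ℕ) (M R : ℝ) where
  Ω : Type
  [fintΩ : Fintype Ω]
  PT : Type
  [fintP : Fintype PT]
  [deqP : DecidableEq PT]
  ZT : Type
  [fintZ : Fintype ZT]
  [deqZ : DecidableEq ZT]
  XT : Type
  [fintX : Fintype XT]
  [deqX : DecidableEq XT]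
  μ : Ω → ℝ
  P : Ω → PT
  W : Ω → Fin N → Fin F → Bool
  D : Ω → UserT C r → Fin N
  ψ : Fin C → PT → (Fin N → Fin F → Bool) → ZT
  φ : PT → (UserT C r → Fin N) → (Fin N → Fin F → Bool) → XT
  μ_nonneg : ∀ ω, 0 ≤ μ ω
  μ_sum_one : ∑ ω, μ ω = 1
  /-- each cache holds `M` files, i.e. `M·F` bits -/
  card_ZT : (Fintype.card ZT : ℝ) ≤ (2 : ℝ) ^ (M * (F : ℝ))
  /-- the transmission consists of `R·F` bits -/
  card_XT : (Fintype.card XT : ℝ) ≤ (2 : ℝ) ^ (R * (F : ℝ))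
  /-- the randomness `P`, the files `W` (i.i.d. uniform `F`-bit strings) and the
  demands `D` (uniform on `[N]^K`) are mutually independent -/
  indep : ∀ (p : PT) (w : Fin N → Fin F → Bool) (d : UserT C r → Fin N),
    probOf μ (fun ω => (P ω, W ω, D ω)) (p, w, d)
      = probOf μ P p * ((1 : ℝ) / (2 : ℝ) ^ (N * F))
          * ((1 : ℝ) / (N : ℝ) ^ (Fintype.card (UserT C r)))
  /-- correctness : `H(W_{d_G} | X, d_G, Z_G) = 0` -/
  correctness : ∀ G : UserT C r,
    condH μ (fun ω => W ω (D ω G))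
      (fun ω => (φ (P ω) (D ω) (W ω), D ω G,
        (fun c : {c : Fin C // c ∈ G.1} => ψ c.1 (P ω) (W ω)))) = 0
  /-- secrecy : `I(W_{[N]∖{d_G}} ; X, Z_G) = 0` -/
  secrecy : ∀ G : UserT C r,
    mutInf μ
      (fun ω => fun i : Fin N =>
        if i = D ω G then (none : Option (Fin F → Bool)) else some (W ω i))
      (fun ω => (φ (P ω) (D ω) (W ω),
        (fun c : {c : Fin C // c ∈ G.1} => ψ c.1 (P ω) (W ω)))) = 0
  /-- demand privacy : `I(d_{−G} ; X, d_G, Z_G) = 0` -/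
  privacy : ∀ G : UserT C r,
    mutInf μ
      (fun ω => fun G' : UserT C r =>
        if G' = G then (none : Option (Fin N)) else some (D ω G'))
      (fun ω => (φ (P ω) (D ω) (W ω), D ω G,
        (fun c : {c : Fin C // c ∈ G.1} => ψ c.1 (P ω) (W ω)))) = 0

section FiniteEntropy

variable {Ω α β : Type} [Fintype Ω] [DecidableEq α] [DecidableEq β] {μ : Ω → ℝ}

lemma probOf_nonneg (hμ : ∀ ω, 0 ≤ μ ω) (X : Ω → α) (a : α) : 0 ≤ probOf μ X a :=
  Finset.sum_nonneg fun ω _ => hμ ω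

lemma probOf_ne_zero_iff (hμ : ∀ ω, 0 ≤ μ ω) (X : Ω → α) (a : α) :
    probOf μ X a ≠ 0 ↔ ∃ ω, μ ω ≠ 0 ∧ X ω = a := by
  rw [probOf, Ne, Finset.sum_eq_zero_iff_of_nonneg fun ω _ => hμ ω]
  simp only [Finset.mem_filter, Finset.mem_univ, true_and]
  push Not
  exact exists_congr fun ω => and_comm

lemma sum_probOf [Fintype α] (X : Ω → α) : ∑ a, probOf μ X a = ∑ ω, μ ω := by
  simp only [probOf]
  exact Finset.sum_fiberwise _ _ _

lemma sum_probOf_prod_right [Fintype β] (X : Ω → α) (Y : Ω → β) (a : α) :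
    ∑ b, probOf μ (fun ω => (X ω, Y ω)) (a, b) = probOf μ X a := by
  simp only [probOf, Prod.mk.injEq, ← Finset.filter_filter]
  exact Finset.sum_fiberwise _ _ _

lemma sum_probOf_prod_left [Fintype α] (X : Ω → α) (Y : Ω → β) (b : β) :
    ∑ a, probOf μ (fun ω => (X ω, Y ω)) (a, b) = probOf μ Y b := by
  have hswap (a : α) : Finset.univ.filter (fun ω => (X ω, Y ω) = (a, b))
      = (Finset.univ.filter fun ω => Y ω = b).filter fun ω => X ω = a := by
    ext ω
    simp [and_comm]
  simp only [probOf, hswap]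
  exact Finset.sum_fiberwise _ _ _

lemma probOf_prod_le_right [Fintype α] (hμ : ∀ ω, 0 ≤ μ ω) (X : Ω → α) (Y : Ω → β)
    (a : α) (b : β) : probOf μ (fun ω => (X ω, Y ω)) (a, b) ≤ probOf μ Y b := by
  rw [← sum_probOf_prod_left X Y b]
  exact Finset.single_le_sum
    (f := fun a => probOf μ (fun ω => (X ω, Y ω)) (a, b))
    (fun a _ => probOf_nonneg hμ _ _) (Finset.mem_univ a)

lemma probOf_prod_le_left [Fintype β] (hμ : ∀ ω, 0 ≤ μ ω) (X : Ω → α) (Y : Ω → β)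
    (a : α) (b : β) : probOf μ (fun ω => (X ω, Y ω)) (a, b) ≤ probOf μ X a := by
  rw [← sum_probOf_prod_right X Y a]
  exact Finset.single_le_sum
    (f := fun b => probOf μ (fun ω => (X ω, Y ω)) (a, b))
    (fun b _ => probOf_nonneg hμ _ _) (Finset.mem_univ b)

lemma sum_negMulLog_probOf_left [Fintype α] [Fintype β] (X : Ω → α) (Y : Ω → β) :
    ∑ a, Real.negMulLog (probOf μ X a)
      = ∑ p : α × β, -(probOf μ (fun ω => (X ω, Y ω)) p * Real.log (probOf μ X p.1)) := by
  rw [Fintype.sum_prod_type]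
  refine Finset.sum_congr rfl fun a _ => ?_
  dsimp only
  rw [Finset.sum_neg_distrib, ← Finset.sum_mul, sum_probOf_prod_right, Real.negMulLog, neg_mul]

lemma sum_negMulLog_probOf_right [Fintype α] [Fintype β] (X : Ω → α) (Y : Ω → β) :
    ∑ b, Real.negMulLog (probOf μ Y b)
      = ∑ p : α × β, -(probOf μ (fun ω => (X ω, Y ω)) p * Real.log (probOf μ Y p.2)) := by
  rw [Fintype.sum_prod_type_right]
  refine Finset.sum_congr rfl fun b _ => ?_
  dsimp only
  rw [Finset.sum_neg_distrib, ← Finset.sum_mul, sum_probOf_prod_left, Real.negMulLog, neg_mul]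

/-- If `H(X | Y) = 0`, then `X` is determined by `Y` almost surely. -/
lemma eq_of_condH_eq_zero [Fintype α] [Fintype β] (hμ : ∀ ω, 0 ≤ μ ω) {X : Ω → α} {Y : Ω → β}
    (h : condH μ X Y = 0) {ω ω' : Ω} (hω : μ ω ≠ 0) (hω' : μ ω' ≠ 0) (hY : Y ω = Y ω') :
    X ω = X ω' := by
  set q := probOf μ (fun ω => (X ω, Y ω)) with hq
  have hq0 (p) : 0 ≤ q p := probOf_nonneg hμ _ p
  have hlog : Real.log 2 ≠ 0 := (Real.log_pos one_lt_two).ne'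
  rw [condH, shannonH, shannonH, ← sub_div, div_eq_zero_iff, or_iff_left hlog,
    sum_negMulLog_probOf_right X Y, ← hq, ← Finset.sum_sub_distrib,
    Finset.sum_eq_zero_iff_of_nonneg] at h
  · have key (a : α) (b : β) (hab : q (a, b) ≠ 0) : q (a, b) = probOf μ Y b := by
      have h1 := h (a, b) (Finset.mem_univ _)
      have hpos := (hq0 (a, b)).lt_of_ne' hab
      have h2 : q (a, b) * (Real.log (probOf μ Y b) - Real.log (q (a, b))) = 0 := by
        rw [Real.negMulLog] at h1
        linarith
      have h3 := (mul_eq_zero.1 h2).resolve_left hab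
      exact Real.log_injOn_pos hpos (hpos.trans_le (probOf_prod_le_right hμ X Y a b))
        (sub_eq_zero.1 h3).symm
    have h1 : q (X ω, Y ω) ≠ 0 := (probOf_ne_zero_iff hμ _ _).2 ⟨ω, hω, rfl⟩
    have h2 : q (X ω', Y ω) ≠ 0 := (probOf_ne_zero_iff hμ _ _).2 ⟨ω', hω', by rw [hY]⟩
    by_contra hne
    have h3 : q (X ω, Y ω) + q (X ω', Y ω) ≤ probOf μ Y (Y ω) := by
      rw [← sum_probOf_prod_left X Y, ← Finset.sum_pair hne (f := fun a => q (a, Y ω))]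
      exact Finset.sum_le_sum_of_subset_of_nonneg (Finset.subset_univ _) fun a _ _ => hq0 _
    rw [key _ _ h1] at h3
    exact h2 (le_antisymm (by linarith) (hq0 _))
  · rintro ⟨a, b⟩ -
    rcases (hq0 (a, b)).eq_or_lt' with h0 | hpos
    · simp [h0]
    · have := Real.log_le_log hpos (probOf_prod_le_right hμ X Y a b)
      have := mul_le_mul_of_nonneg_left this hpos.le
      rw [Real.negMulLog]
      dsimp only
      linarith

/-- If `I(X ; Y) = 0`, then any two values taken by `X` and by `Y` with positive probability
are taken jointly with positive probability. -/
lemma exists_of_mutInf_eq_zero [Fintype α] [Fintype β] (hμ : ∀ ω, 0 ≤ μ ω)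
    (hμ1 : ∑ ω, μ ω = 1) {X : Ω → α} {Y : Ω → β} (h : mutInf μ X Y = 0)
    {ω ω' : Ω} (hω : μ ω ≠ 0) (hω' : μ ω' ≠ 0) :
    ∃ ω'', μ ω'' ≠ 0 ∧ X ω'' = X ω ∧ Y ω'' = Y ω' := by
  set q := probOf μ (fun ω => (X ω, Y ω)) with hq
  have hq0 (p) : 0 ≤ q p := probOf_nonneg hμ _ p
  have hlog : Real.log 2 ≠ 0 := (Real.log_pos one_lt_two).ne'
  rw [mutInf, shannonH, shannonH, shannonH, ← add_div, ← sub_div, div_eq_zero_iff,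
    or_iff_left hlog, sum_negMulLog_probOf_right X Y, sum_negMulLog_probOf_left X Y, ← hq,
    ← Finset.sum_add_distrib, ← Finset.sum_sub_distrib] at h
  have hprod : ∑ p : α × β, (probOf μ X p.1 * probOf μ Y p.2 - q p) = 0 := by
    rw [Finset.sum_sub_distrib, Fintype.sum_prod_type, ← Fintype.sum_mul_sum, hq, sum_probOf,
      sum_probOf, sum_probOf, hμ1]
    norm_num
  rw [← add_zero (∑ p : α × β, _), ← hprod, ← Finset.sum_add_distrib, hprod,
    Finset.sum_eq_zero_iff_of_nonneg] at h
  · have h1 := h (X ω, Y ω') (Finset.mem_univ _)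
    have hX : probOf μ X (X ω) ≠ 0 := (probOf_ne_zero_iff hμ _ _).2 ⟨ω, hω, rfl⟩
    have hY : probOf μ Y (Y ω') ≠ 0 := (probOf_ne_zero_iff hμ _ _).2 ⟨ω', hω', rfl⟩
    have h2 : q (X ω, Y ω') ≠ 0 := by
      intro h0
      simp [h0, hX, hY] at h1
    obtain ⟨ω'', h3, h4⟩ := (probOf_ne_zero_iff hμ _ _).1 h2
    exact ⟨ω'', h3, (Prod.mk.inj h4).1, (Prod.mk.inj h4).2⟩
  · rintro ⟨a, b⟩ -
    dsimp only
    rcases (hq0 (a, b)).eq_or_lt' with h0 | hpos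
    · simpa [h0] using mul_nonneg (probOf_nonneg hμ X a) (probOf_nonneg hμ Y b)
    · have ha : 0 < probOf μ X a := hpos.trans_le (probOf_prod_le_left hμ X Y a b)
      have hb : 0 < probOf μ Y b := hpos.trans_le (probOf_prod_le_right hμ X Y a b)
      have h1 := Real.log_le_sub_one_of_pos (div_pos (mul_pos ha hb) hpos)
      rw [Real.log_div (mul_pos ha hb).ne' hpos.ne', Real.log_mul ha.ne' hb.ne'] at h1
      have h2 := mul_le_mul_of_nonneg_left h1 hpos.le
      rw [mul_sub_one, mul_div_cancel₀ _ hpos.ne'] at h2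
      rw [Real.negMulLog]
      linarith

end FiniteEntropy

/-- A transmission takes at least as many values as a file. -/
lemma CCScheme.two_pow_le_card_XT {C r N F : ℕ} {M R : ℝ} (hrC : r ≤ C) (hN : 2 ≤ N)
    (S : CCScheme C r N F M R) : ∃ n : ℕ, 2 ^ F ≤ n ∧ (n : ℝ) ≤ (2 : ℝ) ^ (R * (F : ℝ)) := by
  obtain ⟨Ω, PT, ZT, XT, μ, P, W, D, ψ, φ, hμ, hμ1, -, hXT, hind, hcor, hsec, -⟩ := S
  refine ⟨Fintype.card XT, ?_, hXT⟩
  obtain ⟨G₀, -, hG₀⟩ := Finset.exists_subset_card_eq (s := (Finset.univ : Finset (Fin C)))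
    (n := r) (by simpa using hrC)
  let G : UserT C r := ⟨G₀, hG₀⟩
  let i₀ : Fin N := ⟨0, by omega⟩
  let i₁ : Fin N := ⟨1, by omega⟩
  have hi : i₀ ≠ i₁ := by simp [i₀, i₁]
  obtain ⟨ω₀, hω₀⟩ : ∃ ω, μ ω ≠ 0 := by
    by_contra! h0
    simp [h0] at hμ1
  have hfull (p : PT) (w : Fin N → Fin F → Bool) (d : UserT C r → Fin N)
      (hp : ∃ ω, μ ω ≠ 0 ∧ P ω = p) : ∃ ω, μ ω ≠ 0 ∧ P ω = p ∧ W ω = w ∧ D ω = d := by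
    have hN0 : (N : ℝ) ≠ 0 := by
      have : N ≠ 0 := by omega
      exact_mod_cast this
    have h1 : probOf μ (fun ω => (P ω, W ω, D ω)) (p, w, d) ≠ 0 := by
      rw [hind]
      have := (probOf_ne_zero_iff hμ P p).2 hp
      positivity
    simpa using (probOf_ne_zero_iff hμ _ _).1 h1
  have hfile (v : Fin F → Bool) : ∃ ω, μ ω ≠ 0 ∧ W ω i₀ = v ∧ D ω G = i₀ ∧
      (fun c : {c : Fin C // c ∈ G.1} => ψ c.1 (P ω) (W ω))
        = fun c : {c : Fin C // c ∈ G.1} => ψ c.1 (P ω₀) (W ω₀) := by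
    obtain ⟨ω₁, h₁, -, hW₁, hD₁⟩ := hfull (P ω₀) (fun _ => v) (fun _ => i₁) ⟨ω₀, hω₀, rfl⟩
    obtain ⟨ω₂, h₂, hA, hB⟩ := exists_of_mutInf_eq_zero hμ hμ1 (hsec G) h₁ hω₀
    have hW₂ : W ω₂ i₀ = v := by
      have := congrFun hA i₀
      simp only [hD₁, hW₁, if_neg hi] at this
      split_ifs at this
      exact Option.some.inj this
    obtain ⟨ω₃, h₃, hP₃, hW₃, hD₃⟩ := hfull (P ω₂) (W ω₂) (fun _ => i₀) ⟨ω₂, h₂, rfl⟩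
    refine ⟨ω₃, h₃, by rw [hW₃, hW₂], by rw [hD₃], ?_⟩
    rw [hP₃, hW₃]
    exact (Prod.mk.inj hB).2
  choose f hf hWf hDf hZf using hfile
  have hinj : Function.Injective fun v => φ (P (f v)) (D (f v)) (W (f v)) := by
    intro v v' hvv
    have := eq_of_condH_eq_zero hμ (hcor G) (hf v) (hf v') (by
      rw [hDf, hDf, hZf, hZf]
      exact congrArg (fun x => (x, _)) hvv)
    simpa only [hDf, hWf] using this
  simpa using Fintype.card_le_of_injective _ hinj

/-- for the multi-access combinatorial topology with `C` caches,
access degree `r`, `K = C(C,r)` users and `N ≥ 2` files, every achievable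
secretive-and-private memory–rate pair `(M, R)` satisfies `R ≥ 1`;
that is, `R*(M) ≥ 1` for every `M`. -/
theorem stmt_4 (C r N : ℕ) (hr1 : 1 ≤ r) (hrC : r ≤ C) (hN : 2 ≤ N) (M R : ℝ)
    (hach : ∃ F : ℕ, 1 ≤ F ∧ Nonempty (CCScheme C r N F M R)) :
    1 ≤ R := by
  obtain ⟨F, hF, ⟨S⟩⟩ := hach
  obtain ⟨n, hn, hnR⟩ := S.two_pow_le_card_XT hrC hN
  have h1 : (2 : ℝ) ^ (F : ℝ) ≤ (2 : ℝ) ^ (R * (F : ℝ)) := by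
    rw [Real.rpow_natCast]
    exact le_trans (by exact_mod_cast hn) hnR
  have h2 : (F : ℝ) ≤ R * F := (Real.rpow_le_rpow_left_iff one_lt_two).1 h1
  have hF0 : (0 : ℝ) < F := by exact_mod_cast hF
  exact le_of_mul_le_mul_right (by linarith) hF0
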